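/- Let B be a finite-dimensional algebra, M a B-module with minimal projective presentation P₁ → P₀ → M → 0, and suppose M is an indecomposable non-projective syzygy (i.e., Ext^i_B(M,B)=0 for all i>0 and M is an indecomposable submodule of a projective). For a vertex x of the quiver of B, if Ext¹_B(M, rad P(x)) ≠ 0 then P(x) is a direct summand of the projective cover P₀ of M. -/

import Mathlib

open CategoryTheory

/-- There exists a nonsplit short exact sequence `0 → N → E → M → 0`;
equivalently, `Ext¹_B(M, N) ≠ 0`. -/
def HasNonsplitExt (B : Type) [Ring B] (N M : Type) [AddCommGroup N] [Module B N]
    [AddCommGroup M] [Module B M] : Prop :=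
  ∃ (E : ModuleCat.{0} B) (ι : N →ₗ[B] E) (π : E →ₗ[B] M),
    Function.Injective ι ∧ Function.Surjective π ∧
      LinearMap.range ι = LinearMap.ker π ∧
      ¬ ∃ σ : M →ₗ[B] E, π.comp σ = LinearMap.id

/-- `M` is an indecomposable module: it is nonzero and is not the direct sum of two
nonzero submodules. -/
def IsIndecomposableModule (B M : Type) [Ring B] [AddCommGroup M] [Module B M] : Prop :=
  Nontrivial M ∧ ∀ N₁ N₂ : Submodule B M, IsCompl N₁ N₂ → N₁ = ⊥ ∨ N₂ = ⊥

/-- The radical `rad M = (rad B)·M` of a module `M` over a finite-dimensional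
algebra `B`, where `rad B` is the Jacobson radical of `B`. -/
def radM (B M : Type) [Ring B] [AddCommGroup M] [Module B M] : Submodule B M :=
  Submodule.span B {x : M | ∃ r ∈ Ideal.jacobson (⊥ : Ideal B), ∃ m : M, x = r • m}

section Semiprimary

variable {B P : Type*} [Ring B] [AddCommGroup P] [Module B P]

/-- Nakayama's lemma over a semiprimary ring, without finiteness assumption on the module. -/
theorem IsSemiprimaryRing.eq_top_of_sup_jacobson_smul_top [IsSemiprimaryRing B]
    {N : Submodule B P} (h : N ⊔ Ring.jacobson B • (⊤ : Submodule B P) = ⊤) : N = ⊤ := by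
  obtain ⟨n, hn⟩ := IsSemiprimaryRing.isNilpotent (R := B)
  have key (k : ℕ) : N ⊔ Ring.jacobson B ^ k • (⊤ : Submodule B P) = ⊤ := by
    induction k with
    | zero => rw [Submodule.pow_zero, Ideal.one_eq_top, Submodule.top_smul]; exact sup_top_eq N
    | succ k ih =>
      refine eq_top_iff.2 (ih.ge.trans (sup_le le_sup_left ?_))
      calc Ring.jacobson B ^ k • (⊤ : Submodule B P)
          = Ring.jacobson B ^ k • N ⊔ Ring.jacobson B ^ (k + 1) • (⊤ : Submodule B P) := by
            rw [Submodule.pow_succ, Submodule.mul_smul, ← Submodule.smul_sup, h]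
        _ ≤ _ := sup_le_sup_right Submodule.smul_le_right _
  have := key n
  rwa [hn, Submodule.zero_eq_bot, Submodule.bot_smul, sup_bot_eq] at this

theorem Submodule.smul_top_le_comap_smul_top' (I : Ideal B) (φ : Module.End B P) :
    I • (⊤ : Submodule B P) ≤ (I • (⊤ : Submodule B P)).comap φ := by
  rw [← Submodule.map_le_iff_le_comap, Submodule.map_smul'']
  exact smul_mono_right _ le_top

/-- The action of endomorphisms of `P` on the quotient `P / I P`. -/
def Module.End.mapQuotSMulTop (I : Ideal B) :
    Module.End B P →+* Module.End B (P ⧸ I • (⊤ : Submodule B P)) where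
  toFun φ := Submodule.mapQ _ _ φ (Submodule.smul_top_le_comap_smul_top' I φ)
  map_one' := by ext; rfl
  map_mul' _ _ := by ext; rfl
  map_zero' := by ext; rfl
  map_add' _ _ := by ext; rfl

theorem Module.End.mapQuotSMulTop_surjective [Module.Projective B P] (I : Ideal B) :
    Function.Surjective (Module.End.mapQuotSMulTop (P := P) I) := by
  intro ψ
  obtain ⟨φ, hφ⟩ := Module.projective_lifting_property
    (I • (⊤ : Submodule B P)).mkQ (ψ ∘ₗ (I • (⊤ : Submodule B P)).mkQ)
    (Submodule.mkQ_surjective _)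
  refine ⟨φ, ?_⟩
  ext x
  exact LinearMap.congr_fun hφ x

theorem Module.End.isNilpotent_of_mem_ker_mapQuotSMulTop {I : Ideal B} (hI : IsNilpotent I)
    (φ : Module.End B P) (hφ : φ ∈ RingHom.ker (Module.End.mapQuotSMulTop (P := P) I)) :
    IsNilpotent φ := by
  obtain ⟨n, hn⟩ := hI
  have hrange : (⊤ : Submodule B P).map φ ≤ I • ⊤ := by
    rintro _ ⟨x, -, rfl⟩
    exact (Submodule.Quotient.mk_eq_zero _).1 (LinearMap.congr_fun hφ (Submodule.Quotient.mk x))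
  have key (k : ℕ) : (⊤ : Submodule B P).map (φ ^ k) ≤ I ^ k • ⊤ := by
    induction k with
    | zero => rw [Submodule.pow_zero, Ideal.one_eq_top, Submodule.top_smul]; exact le_top
    | succ k ih =>
      rw [pow_succ' φ, Module.End.mul_eq_comp, Submodule.map_comp, Submodule.pow_succ, Submodule.mul_smul]
      refine (Submodule.map_mono ih).trans ?_
      rw [Submodule.map_smul'']
      exact smul_mono_right _ hrange
  refine ⟨n, LinearMap.ext fun x ↦ ?_⟩
  have := key n ⟨x, trivial, rfl⟩
  simpa [hn] using this

/-- Over a semiprimary ring, the top of an arbitrary module is semisimple. -/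
theorem IsSemiprimaryRing.isSemisimpleModule_quotient_jacobson_smul_top [IsSemiprimaryRing B] :
    IsSemisimpleModule B (P ⧸ Ring.jacobson B • (⊤ : Submodule B P)) := by
  have h : Module.IsTorsionBySet B (P ⧸ Ring.jacobson B • (⊤ : Submodule B P))
      (Ring.jacobson B) := by
    rw [Module.isTorsionBySet_quotient_iff]
    exact fun m i hi ↦ Submodule.smul_mem_smul hi trivial
  let _ := h.module
  exact (h.semilinearMap.isSemisimpleModule_iff_of_bijective Function.bijective_id).2
    inferInstance

end Semiprimary

theorem radM_eq_jacobson_smul_top (B M : Type) [Ring B] [AddCommGroup M] [Module B M] :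
    radM B M = Ring.jacobson B • (⊤ : Submodule B M) := by
  refine le_antisymm (Submodule.span_le.2 ?_) (Submodule.smul_le.2 fun r hr m _ ↦ ?_)
  · rintro _ ⟨r, hr, m, rfl⟩
    exact Submodule.smul_mem_smul (Ideal.jacobson_bot (R := B) ▸ hr) trivial
  · exact Submodule.subset_span ⟨r, (Ideal.jacobson_bot (R := B)).symm ▸ hr, m, rfl⟩

theorem radM_ne_top (B M : Type) [Ring B] [IsSemiprimaryRing B] [AddCommGroup M] [Module B M]
    [Nontrivial M] : radM B M ≠ ⊤ := by
  intro h
  rw [radM_eq_jacobson_smul_top] at h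
  exact bot_ne_top (IsSemiprimaryRing.eq_top_of_sup_jacobson_smul_top (B := B) (P := M)
    (by rwa [bot_sup_eq]))

namespace IsIndecomposableModule

variable {B P : Type} [Ring B] [IsSemiprimaryRing B] [AddCommGroup P] [Module B P]
  [Module.Projective B P]

/-- In an indecomposable projective module over a semiprimary ring, every proper submodule
is contained in the radical. -/
theorem eq_top_of_not_le_radM (hP : IsIndecomposableModule B P) {N : Submodule B P}
    (hN : ¬ N ≤ radM B P) : N = ⊤ := by
  rw [radM_eq_jacobson_smul_top] at hN
  have := IsSemiprimaryRing.isSemisimpleModule_quotient_jacobson_smul_top (B := B) (P := P)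
  obtain ⟨L, hL⟩ := exists_isCompl (N.map (Ring.jacobson B • (⊤ : Submodule B P)).mkQ)
  obtain ⟨e, he, hfe⟩ := exists_isIdempotentElem_eq_of_ker_isNilpotent
    (Module.End.mapQuotSMulTop (P := P) (Ring.jacobson B))
    (Module.End.isNilpotent_of_mem_ker_mapQuotSMulTop IsSemiprimaryRing.isNilpotent)
    (Submodule.projection _ _ hL) (RingHom.mem_range.2 (Module.End.mapQuotSMulTop_surjective _ _))
    (Submodule.isIdempotentElem_projection hL)
  apply IsSemiprimaryRing.eq_top_of_sup_jacobson_smul_top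
  rcases hP.2 _ _ (LinearMap.IsIdempotentElem.isCompl he) with h | h
  · exfalso
    have h0 : e = 0 := LinearMap.range_eq_bot.1 h
    rw [h0, map_zero] at hfe
    refine hN fun x hx ↦ (Submodule.Quotient.mk_eq_zero _).1 ?_
    have hx' : (Ring.jacobson B • (⊤ : Submodule B P)).mkQ x ∈ N.map _ :=
      Submodule.mem_map_of_mem hx
    have := Submodule.projection_apply_left hL ⟨_, hx'⟩
    rw [← hfe] at this
    exact this.symm
  · have h1 : e = 1 := by
      ext x
      exact LinearMap.ker_eq_bot.1 h (LinearMap.congr_fun he x)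
    rw [h1, map_one] at hfe
    have hr := Submodule.range_projection hL
    rw [← hfe, show LinearMap.range (1 : Module.End B (P ⧸ _)) = ⊤ from LinearMap.range_id] at hr
    have := congrArg (Submodule.comap (Ring.jacobson B • (⊤ : Submodule B P)).mkQ) hr
    rw [Submodule.comap_map_mkQ, Submodule.comap_top] at this
    rw [sup_comm]
    exact this.symm

/-- An indecomposable projective module over a semiprimary ring is a direct summand of the
regular module. -/
theorem exists_retraction_of_ring (hP : IsIndecomposableModule B P) :
    ∃ (s : P →ₗ[B] B) (r : B →ₗ[B] P), r ∘ₗ s = LinearMap.id := by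
  have := hP.1
  obtain ⟨x, -, hx⟩ := SetLike.exists_of_lt (radM_ne_top B P).lt_top
  have hr : LinearMap.range (LinearMap.toSpanSingleton B P x) = ⊤ :=
    hP.eq_top_of_not_le_radM fun h ↦ hx (h ⟨1, by simp⟩)
  obtain ⟨s, hs⟩ := Module.projective_lifting_property
    (LinearMap.toSpanSingleton B P x) LinearMap.id (LinearMap.range_eq_top.1 hr)
  exact ⟨s, _, hs⟩

end IsIndecomposableModule

/-- If `Ext¹(M, Y) = 0`, every map from the kernel of an extension of `M` to `Y` extends. -/
theorem exists_extension_of_subsingleton_ext {B : Type} [Ring B] [HasExt.{0} (ModuleCat.{0} B)]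
    {N E M Y : Type} [AddCommGroup N] [Module B N] [AddCommGroup E] [Module B E]
    [AddCommGroup M] [Module B M] [AddCommGroup Y] [Module B Y]
    [Subsingleton (Abelian.Ext (ModuleCat.of B M) (ModuleCat.of B Y) 1)]
    {ι : N →ₗ[B] E} {π : E →ₗ[B] M} (hι : Function.Injective ι) (hπ : Function.Surjective π)
    (hex : Function.Exact ι π) (φ : N →ₗ[B] Y) : ∃ h : E →ₗ[B] Y, h ∘ₗ ι = φ := by
  let S : ShortComplex (ModuleCat.{0} B) :=
    ShortComplex.mk (ModuleCat.ofHom ι) (ModuleCat.ofHom π)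
      (by ext x; exact hex.apply_apply_eq_zero x)
  have hS : S.ShortExact :=
    { exact := (ShortComplex.ShortExact.moduleCat_exact_iff_function_exact S).2 hex
      mono_f := (ModuleCat.mono_iff_injective _).2 hι
      epi_g := (ModuleCat.epi_iff_surjective _).2 hπ }
  obtain ⟨x, hx⟩ := Abelian.Ext.contravariant_sequence_exact₁ hS
    (ModuleCat.of B Y) (Abelian.Ext.mk₀ (ModuleCat.ofHom φ : S.X₁ ⟶ ModuleCat.of B Y)) (add_zero 1)
    (Subsingleton.elim (α := Abelian.Ext (ModuleCat.of B M) (ModuleCat.of B Y) 1) _ _)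
  obtain ⟨h, rfl⟩ := (Abelian.Ext.mk₀_bijective _ _).2 x
  rw [Abelian.Ext.mk₀_comp_mk₀] at hx
  have := (Abelian.Ext.mk₀_bijective _ _).1 hx
  exact ⟨h.hom, congrArg ModuleCat.Hom.hom this⟩

/-- The inclusion of the kernel of a nonsplit extension into an overmodule extends only to maps
whose image is not contained in that kernel. -/
theorem not_range_le_of_not_split {B E M Q : Type*} [Ring B] [AddCommGroup E] [Module B E]
    [AddCommGroup M] [Module B M] [AddCommGroup Q] [Module B Q] {N : Submodule B Q}
    {ι : N →ₗ[B] E} {π : E →ₗ[B] M} (hι : Function.Injective ι) (hπ : Function.Surjective π)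
    (hex : Function.Exact ι π) (hns : ¬ ∃ σ : M →ₗ[B] E, π ∘ₗ σ = LinearMap.id)
    {h : E →ₗ[B] Q} (hh : h ∘ₗ ι = N.subtype) : ¬ LinearMap.range h ≤ N := by
  intro hle
  have hretr : ∃ l : E →ₗ[B] N, l ∘ₗ ι = LinearMap.id :=
    ⟨h.codRestrict N fun x ↦ hle (LinearMap.mem_range_self h x),
      LinearMap.ext fun x ↦ Subtype.ext (LinearMap.congr_fun hh x)⟩
  exact hns (((hex.split_tfae hι hπ).out 0 1).2 hretr)

/-- Let `B` be a finite-dimensional (basic) algebra over an algebraically closed field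
`𝕜`, and let `M` be an indecomposable non-projective syzygy, i.e. `Ext^i_B(M,B) = 0`
for all `i > 0` and `M` is an indecomposable submodule of a projective module.  Let
`P₁ →g P₀ →p M → 0` be a minimal projective presentation of `M` (so `p : P₀ → M` and
the induced map `P₁ → ker p` are projective covers).  If, for a vertex `x` of the
quiver of `B` with indecomposable projective `P(x) = Px`,
`Ext¹_B(M, rad P(x)) ≠ 0`, then `P(x)` is a direct summand of the projective cover
`P₀` of `M`. -/
theorem ext_rad_nonzero_implies_summand_of_cover
    (𝕜 B : Type) [Field 𝕜] [IsAlgClosed 𝕜] [Ring B] [Algebra 𝕜 B]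
    [FiniteDimensional 𝕜 B] [HasExt.{0} (ModuleCat B)]
    (M : Type) [AddCommGroup M] [Module B M] [Module.Finite B M]
    (hind : IsIndecomposableModule B M)
    (hnonproj : ¬ Module.Projective B M)
    (hsyz : ∀ i : ℕ, 0 < i →
      Subsingleton (Abelian.Ext (ModuleCat.of B M) (ModuleCat.of B B) i))
    (hsub : ∃ (P : ModuleCat B), Module.Projective B P ∧
      ∃ f : M →ₗ[B] P, Function.Injective f)
    (P₀ P₁ : Type) [AddCommGroup P₀] [Module B P₀] [AddCommGroup P₁] [Module B P₁]
    (hP₀ : Module.Projective B P₀) (hP₁ : Module.Projective B P₁)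
    (p : P₀ →ₗ[B] M) (g : P₁ →ₗ[B] P₀)
    (hp : Function.Surjective p)
    (hg : LinearMap.range g = LinearMap.ker p)
    (hmin₀ : ∀ N : Submodule B P₀, N ⊔ LinearMap.ker p = ⊤ → N = ⊤)
    (hmin₁ : ∀ N : Submodule B P₁, N ⊔ LinearMap.ker g = ⊤ → N = ⊤)
    (Px : Type) [AddCommGroup Px] [Module B Px]
    (hPx : Module.Projective B Px) (hPxind : IsIndecomposableModule B Px)
    (hext : HasNonsplitExt B (↥(radM B Px)) M) :
    ∃ N N' : Submodule B P₀, IsCompl N N' ∧ Nonempty (↥N ≃ₗ[B] Px) := by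
  obtain ⟨E, ι, π, hι, hπ, hιπ, hns⟩ := hext
  have : IsArtinianRing B := IsArtinianRing.of_finite 𝕜 B
  have hex : Function.Exact ι π := LinearMap.exact_iff.2 hιπ.symm
  obtain ⟨s, r, hrs⟩ := hPxind.exists_retraction_of_ring
  have := hsyz 1 one_pos
  obtain ⟨h', hh'⟩ := exists_extension_of_subsingleton_ext hι hπ hex (s ∘ₗ (radM B Px).subtype)
  let h : E →ₗ[B] Px := r ∘ₗ h'
  have hh : h ∘ₗ ι = (radM B Px).subtype := by
    rw [LinearMap.comp_assoc, hh', ← LinearMap.comp_assoc, hrs, LinearMap.id_comp]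
  have hrange := not_range_le_of_not_split hι hπ hex hns hh
  obtain ⟨q, hq⟩ := Module.projective_lifting_property π p hπ
  have hsurj : LinearMap.range (h ∘ₗ q) = ⊤ := by
    refine hPxind.eq_top_of_not_le_radM fun hle ↦ hrange ?_
    rintro _ ⟨e, rfl⟩
    obtain ⟨y, hy⟩ := hp (π e)
    obtain ⟨n, hn⟩ := (hex (e - q y)).1 (by
      rw [map_sub, ← LinearMap.comp_apply, hq, hy, sub_self])
    have he : h e = h (ι n) + h (q y) := by rw [hn, ← map_add, sub_add_cancel]
    rw [he, ← LinearMap.comp_apply, hh]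
    exact add_mem n.2 (hle ⟨y, rfl⟩)
  obtain ⟨t, ht⟩ := Module.projective_lifting_property (h ∘ₗ q) LinearMap.id
    (LinearMap.range_eq_top.1 hsurj)
  have hid : IsIdempotentElem (t ∘ₗ h ∘ₗ q : Module.End B P₀) := by
    ext y
    exact congrArg t (LinearMap.congr_fun ht (h (q y)))
  exact ⟨_, _, LinearMap.IsIdempotentElem.isCompl hid,
    ⟨(LinearEquiv.ofEq _ _ (LinearMap.range_comp_of_range_eq_top t hsurj)).trans
      (LinearEquiv.ofInjective t (LinearMap.injective_of_comp_eq_id _ _ ht)).symm⟩⟩
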